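/- Let A be a set of natural numbers, P a Π⁰₁ class of positive measure, and Q a Π⁰₁(A) class containing only sequences that are Martin-Löf random relative to A. If P ⊆ Q, then every Martin-Löf random sequence is Martin-Löf random relative to A (i.e., A is low for Martin-Löf randomness, hence K-trivial). -/

import Mathlib

open MeasureTheory ENNReal

/-! ### Cantor space and the uniform (coin-flipping) measure -/

/-- The binary digits of a real number in `[0,1)`, giving a point of Cantor space. -/
noncomputable def binaryDigits (x : ℝ) : ℕ → Bool :=
  fun n => decide (⌊x * 2 ^ (n + 1)⌋ % 2 = 1)

/-- The uniform (Lebesgue / coin-flipping) measure on Cantor space `2^ω`,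
obtained as the pushforward of Lebesgue measure on `[0,1)` under binary expansion. -/
noncomputable def μCantor : Measure (ℕ → Bool) :=
  Measure.map binaryDigits (volume.restrict (Set.Ico (0 : ℝ) 1))

/-- `σ` is an initial segment of the infinite sequence `X`. -/
def IsPrefixOf (σ : List Bool) (X : ℕ → Bool) : Prop :=
  ∀ i : Fin σ.length, X i = σ.get i

/-- The cylinder determined by a finite binary string. -/
def cylinder (σ : List Bool) : Set (ℕ → Bool) := {X | IsPrefixOf σ X}

/-- The open set generated by a set of finite binary strings. -/
def openOf (S : Set (List Bool)) : Set (ℕ → Bool) := ⋃ σ ∈ S, cylinder σ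

/-- The density of a set `P` above the string `τ`: `μ([τ] ∩ P) · 2^{|τ|}`. -/
noncomputable def dens (τ : List Bool) (P : Set (ℕ → Bool)) : ℝ≥0∞ :=
  μCantor (cylinder τ ∩ P) * 2 ^ τ.length

/-- The length-`n` initial segment of `X`, as a finite binary string. -/
def strPrefix (X : ℕ → Bool) (n : ℕ) : List Bool := (List.range n).map X

/-- A set of strings is prefix-free if no element is a proper prefix of another. -/
def PrefixFreeSet (S : Set (List Bool)) : Prop :=
  ∀ σ ∈ S, ∀ τ ∈ S, σ <+: τ → σ = τ

/-- The weight `∑_{σ ∈ S} 2^{-|σ|}` of a set of strings. -/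
noncomputable def weight (S : Set (List Bool)) : ℝ≥0∞ :=
  ∑' σ : S, 2⁻¹ ^ (σ : List Bool).length

/-- A set of strings is bounded if its weight is finite. -/
def BoundedStr (S : Set (List Bool)) : Prop := weight S < ⊤

/-- The tail `X(·+k)` of an infinite binary sequence. -/
def tailSeq (X : ℕ → Bool) (k : ℕ) : ℕ → Bool := fun n => X (n + k)

/-! ### Oracle computability -/

/-- The `e`-th computably enumerable set of naturals (the domain of the `e`-th
partial computable function). -/
def WEnum (e n : ℕ) : Prop := ((Denumerable.ofNat Nat.Partrec.Code e).eval n).Dom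

/-- `OracleComputes e X n m` holds if the `e`-th Turing functional with oracle `X`
outputs `m` on input `n`; a Turing functional is presented by the c.e. set `W_e`
of coded axioms `(σ, n, m)`, and `Γ_e^X(n) = m` iff some initial segment `σ` of `X`
has `(σ, n, m) ∈ W_e`. -/
def OracleComputes (e : ℕ) (X : ℕ → Bool) (n m : ℕ) : Prop :=
  ∃ σ : List Bool, IsPrefixOf σ X ∧
    WEnum e (Nat.pair (Encodable.encode σ) (Nat.pair n m))

def natOfBool (b : Bool) : ℕ := cond b 1 0

/-- `f : ℕ → ℕ` is computable with oracle `A`: some Turing functional with oracle `A`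
has graph exactly `f`. -/
def FnComputableIn (f : ℕ → ℕ) (A : ℕ → Bool) : Prop :=
  ∃ e, ∀ n m, OracleComputes e A n m ↔ m = f n

/-- Turing reducibility `B ≤_T A` for subsets of `ω` (as elements of Cantor space). -/
def TuringLE (B A : ℕ → Bool) : Prop := FnComputableIn (fun n => natOfBool (B n)) A

/-- Turing equivalence. -/
def TuringEquiv (A B : ℕ → Bool) : Prop := TuringLE A B ∧ TuringLE B A

/-- The Turing join `A ⊕ B`. -/
def joinSet (A B : ℕ → Bool) : ℕ → Bool :=
  fun n => if n % 2 = 0 then A (n / 2) else B (n / 2)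

open Classical in
/-- The Turing jump `A′ = {e : Γ_e^A(e)↓}`. -/
noncomputable def jump (A : ℕ → Bool) : ℕ → Bool :=
  fun e => decide (∃ m, OracleComputes e A e m)

/-- The empty oracle. -/
def emptyOracle : ℕ → Bool := fun _ => false

/-- The halting problem `∅′`. -/
noncomputable def zeroJump : ℕ → Bool := jump emptyOracle

/-- A set is computable iff it is Turing reducible to the empty oracle. -/
def ComputableSet (A : ℕ → Bool) : Prop := TuringLE A emptyOracle

/-- A set of naturals is c.e. in `A`. -/
def CeIn (A : ℕ → Bool) (S : Set ℕ) : Prop :=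
  ∃ e, ∀ n, n ∈ S ↔ ∃ m, OracleComputes e A n m

/-- A set of strings is c.e. in `A`. -/
def CeStrIn (A : ℕ → Bool) (S : Set (List Bool)) : Prop :=
  ∃ e, ∀ σ : List Bool, σ ∈ S ↔ ∃ m, OracleComputes e A (Encodable.encode σ) m

/-- A c.e. set of strings. -/
def CeStr (S : Set (List Bool)) : Prop := CeStrIn emptyOracle S

/-! ### Π⁰₁ classes, Martin-Löf randomness, K-triviality -/

/-- A `Π⁰₁(A)` class: the complement of the union of cylinders over an `A`-c.e.
set of strings. -/
def Pi01In (A : ℕ → Bool) (P : Set (ℕ → Bool)) : Prop :=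
  ∃ S : Set (List Bool), CeStrIn A S ∧ P = (openOf S)ᶜ

/-- A `Π⁰₁` class. -/
def Pi01 (P : Set (ℕ → Bool)) : Prop := Pi01In emptyOracle P

/-- The `n`-th level of the `e`-th `A`-effective sequence of open sets. -/
def testLevel (e : ℕ) (A : ℕ → Bool) (n : ℕ) : Set (ℕ → Bool) :=
  openOf {σ | ∃ m, OracleComputes e A (Nat.pair n (Encodable.encode σ)) m}

/-- A Martin-Löf test relative to `A`: a uniformly `A`-c.e. sequence of open sets
`G n` with `μ(G n) ≤ 2^{-n}`. -/
def MLTestIn (A : ℕ → Bool) (G : ℕ → Set (ℕ → Bool)) : Prop :=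
  (∃ e, ∀ n, G n = testLevel e A n) ∧ ∀ n, μCantor (G n) ≤ 2⁻¹ ^ n

/-- `X` is Martin-Löf random relative to `A`: it passes every `A`-Martin-Löf test. -/
def MLRandomIn (A X : ℕ → Bool) : Prop :=
  ∀ G : ℕ → Set (ℕ → Bool), MLTestIn A G → ∃ n, X ∉ G n

/-- `X` is Martin-Löf random. -/
def MLRandom (X : ℕ → Bool) : Prop := MLRandomIn emptyOracle X

/-- The domain of the `e`-th machine, viewed as a set of binary strings. -/
def machineDom (e : ℕ) : Set (List Bool) :=
  {σ | ((Denumerable.ofNat Nat.Partrec.Code e).eval (Encodable.encode σ)).Dom}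

/-- The `e`-th machine is prefix-free. -/
def PrefixFreeMachine (e : ℕ) : Prop := PrefixFreeSet (machineDom e)

/-- Prefix-free Kolmogorov complexity (defined, up to an additive constant, as the
least `|σ| + 2e + 2` over prefix-free machines `e` and programs `σ` producing `x`). -/
noncomputable def Kcpx (x : ℕ) : ℕ :=
  sInf {k | ∃ e, ∃ σ : List Bool, PrefixFreeMachine e ∧
    x ∈ (Denumerable.ofNat Nat.Partrec.Code e).eval (Encodable.encode σ) ∧
    k = σ.length + 2 * e + 2}

/-- `K(n)` means `K(1^n)`. -/
noncomputable def KofNat (n : ℕ) : ℕ := Kcpx (Encodable.encode (List.replicate n true))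

/-- `A` is K-trivial: `K(A↾n) ≤ K(n) + c` for some constant `c`. -/
def KTrivial (A : ℕ → Bool) : Prop :=
  ∃ c, ∀ n, Kcpx (Encodable.encode (strPrefix A n)) ≤ KofNat n + c

/-! ### Strings and prefixes -/

theorem isPrefixOf_cons (b : Bool) (σ : List Bool) (X : ℕ → Bool) :
    IsPrefixOf (b :: σ) X ↔ X 0 = b ∧ IsPrefixOf σ (tailSeq X 1) := by
  unfold IsPrefixOf tailSeq
  constructor
  · intro h
    refine ⟨h ⟨0, by simp⟩, fun i => ?_⟩
    have := h ⟨i.1 + 1, by simp⟩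
    simpa using this
  · rintro ⟨h0, h⟩ ⟨i, hi⟩
    cases i with
    | zero => simpa using h0
    | succ i => simpa using h ⟨i, by simpa using hi⟩

theorem isPrefixOf_nil (X : ℕ → Bool) : IsPrefixOf [] X := fun i => i.elim0

theorem tailSeq_tailSeq (X : ℕ → Bool) (a b : ℕ) :
    tailSeq (tailSeq X a) b = tailSeq X (b + a) := by
  funext n; simp [tailSeq, Nat.add_assoc]

theorem tailSeq_zero (X : ℕ → Bool) : tailSeq X 0 = X := rfl

theorem isPrefixOf_append (σ τ : List Bool) (X : ℕ → Bool) :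
    IsPrefixOf (σ ++ τ) X ↔ IsPrefixOf σ X ∧ IsPrefixOf τ (tailSeq X σ.length) := by
  induction σ generalizing X with
  | nil => simp [isPrefixOf_nil, tailSeq_zero]
  | cons b σ ih =>
    simp [isPrefixOf_cons, ih, tailSeq_tailSeq, and_assoc]

theorem strPrefix_length (X : ℕ → Bool) (n : ℕ) : (strPrefix X n).length = n := by
  simp [strPrefix]

theorem isPrefixOf_iff (σ : List Bool) (X : ℕ → Bool) :
    IsPrefixOf σ X ↔ σ = strPrefix X σ.length := by
  unfold IsPrefixOf strPrefix
  constructor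
  · intro h
    apply List.ext_getElem
    · simp
    · intro i h1 h2
      have := h ⟨i, h1⟩
      simpa using this.symm
  · intro h i
    have h2 : σ.get i = σ[i.1] := rfl
    rw [h2]
    have h3 : σ[i.1]? = ((List.range σ.length).map X)[i.1]? := by rw [← h]
    rw [List.getElem?_eq_getElem i.2] at h3
    simp at h3
    exact h3.symm

theorem isPrefixOf_strPrefix (X : ℕ → Bool) (n : ℕ) : IsPrefixOf (strPrefix X n) X := by
  rw [isPrefixOf_iff, strPrefix_length]

theorem strPrefix_take (X : ℕ → Bool) {i n : ℕ} (h : i ≤ n) :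
    (strPrefix X n).take i = strPrefix X i := by
  simp [strPrefix, ← List.map_take, List.take_range, h]

theorem strPrefix_dropLast (X : ℕ → Bool) (n : ℕ) :
    (strPrefix X (n + 1)).take n = strPrefix X n := strPrefix_take X (Nat.le_succ n)

theorem mem_openOf (S : Set (List Bool)) (X : ℕ → Bool) :
    X ∈ openOf S ↔ ∃ σ ∈ S, IsPrefixOf σ X := by
  simp only [openOf, Set.mem_iUnion, exists_prop]; rfl

theorem mem_openOf' (S : Set (List Bool)) (X : ℕ → Bool) :
    X ∈ openOf S ↔ ∃ n, strPrefix X n ∈ S := by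
  rw [mem_openOf]
  constructor
  · rintro ⟨σ, hσ, h⟩
    exact ⟨σ.length, by rwa [← (isPrefixOf_iff σ X).1 h]⟩
  · rintro ⟨n, hn⟩
    exact ⟨_, hn, isPrefixOf_strPrefix X n⟩

/-! ### Measure -/

theorem measurable_binaryDigits : Measurable binaryDigits := by
  refine measurable_pi_iff.2 fun n => ?_
  unfold binaryDigits
  have h1 : Measurable fun x : ℝ => ⌊x * 2 ^ (n + 1)⌋ := by fun_prop
  exact (measurable_of_countable (fun z : ℤ => decide (z % 2 = 1))).comp h1

theorem measurable_tailSeq (k : ℕ) : Measurable fun X : ℕ → Bool => tailSeq X k :=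
  measurable_pi_iff.2 fun n => measurable_pi_apply (n + k)

theorem measurableSet_cylinder (σ : List Bool) : MeasurableSet (cylinder σ) := by
  have : cylinder σ = ⋂ i : Fin σ.length, {X | X i = σ.get i} := by
    ext X; rw [Set.mem_iInter]; rfl
  rw [this]
  refine MeasurableSet.iInter fun i => ?_
  exact measurableSet_eq_fun (measurable_pi_apply (i : ℕ)) measurable_const

theorem measurableSet_openOf (S : Set (List Bool)) : MeasurableSet (openOf S) :=
  MeasurableSet.biUnion S.to_countable fun σ _ => measurableSet_cylinder σ

theorem μCantor_apply {V : Set (ℕ → Bool)} (hV : MeasurableSet V) :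
    μCantor V = volume (binaryDigits ⁻¹' V ∩ Set.Ico 0 1) := by
  rw [μCantor, Measure.map_apply measurable_binaryDigits hV,
    Measure.restrict_apply (measurable_binaryDigits hV)]

instance : IsProbabilityMeasure μCantor := ⟨by
  rw [μCantor_apply MeasurableSet.univ]; simp⟩

theorem binaryDigits_tail (x : ℝ) (c : ℤ) :
    tailSeq (binaryDigits x) 1 = binaryDigits (2 * x - c) := by
  funext n
  simp only [tailSeq, binaryDigits]
  have : (2 * x - c) * 2 ^ (n + 1) = x * 2 ^ (n + 1 + 1) - ((c * 2 ^ (n + 1) : ℤ) : ℝ) := by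
    push_cast; ring
  rw [this, Int.floor_sub_intCast]
  congr 2
  have h2 : c * 2 ^ (n + 1) = c * 2 ^ n * 2 := by rw [pow_succ, ← mul_assoc]
  rw [h2]
  omega

theorem binaryDigits_zero (x : ℝ) (hx : x ∈ Set.Ico (0 : ℝ) 1) (b : Bool) :
    binaryDigits x 0 = b ↔ 2 * x - (natOfBool b : ℤ) ∈ Set.Ico (0 : ℝ) 1 := by
  obtain ⟨h0, h1⟩ := hx
  simp only [binaryDigits]
  by_cases h : x * 2 < 1
  · have : ⌊x * 2 ^ (0 + 1)⌋ = 0 := by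
      rw [Int.floor_eq_iff]; norm_num; constructor <;> linarith
    rw [this]
    cases b <;> simp [natOfBool] <;> first | (intros; linarith) | (constructor <;> linarith)
  · have : ⌊x * 2 ^ (0 + 1)⌋ = 1 := by
      rw [Int.floor_eq_iff]; norm_num; constructor <;> linarith
    rw [this]
    cases b <;> simp [natOfBool] <;> first | (intros; linarith) | (constructor <;> linarith)

theorem μCantor_step (b : Bool) {V : Set (ℕ → Bool)} (hV : MeasurableSet V) :
    μCantor {X | X 0 = b ∧ tailSeq X 1 ∈ V} = 2⁻¹ * μCantor V := by
  have hm : MeasurableSet {X : ℕ → Bool | X 0 = b ∧ tailSeq X 1 ∈ V} :=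
    (measurableSet_eq_fun (measurable_pi_apply 0) measurable_const).inter (measurable_tailSeq 1 hV)
  rw [μCantor_apply hm, μCantor_apply hV]
  have : binaryDigits ⁻¹' {X | X 0 = b ∧ tailSeq X 1 ∈ V} ∩ Set.Ico 0 1
      = (fun x : ℝ => 2 * x) ⁻¹' ((fun y : ℝ => y + (-((natOfBool b : ℤ) : ℝ))) ⁻¹'
        (binaryDigits ⁻¹' V ∩ Set.Ico 0 1)) := by
    ext x
    simp only [Set.mem_inter_iff, Set.mem_preimage, Set.mem_ofPred_eq, ← sub_eq_add_neg]
    rw [binaryDigits_tail x (natOfBool b : ℤ)]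
    constructor
    · rintro ⟨⟨h1, h2⟩, h3⟩
      exact ⟨h2, (binaryDigits_zero x h3 b).1 h1⟩
    · rintro ⟨h1, h2⟩
      have h3 : x ∈ Set.Ico (0 : ℝ) 1 := by
        obtain ⟨h4, h5⟩ := h2
        cases b <;> simp [natOfBool] at h4 h5 <;> constructor <;> linarith
      exact ⟨⟨(binaryDigits_zero x h3 b).2 h2, h1⟩, h3⟩
  rw [this, Real.volume_preimage_mul_left (by norm_num), measure_preimage_add_right]
  congr 1
  rw [abs_of_pos (by norm_num), ENNReal.ofReal_inv_of_pos (by norm_num)]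
  simp

theorem μCantor_shift (σ : List Bool) {V : Set (ℕ → Bool)} (hV : MeasurableSet V) :
    μCantor {X | IsPrefixOf σ X ∧ tailSeq X σ.length ∈ V} = 2⁻¹ ^ σ.length * μCantor V := by
  induction σ with
  | nil => simp [isPrefixOf_nil, tailSeq_zero]
  | cons b σ ih =>
    have hm : MeasurableSet {X | IsPrefixOf σ X ∧ tailSeq X σ.length ∈ V} :=
      (measurableSet_cylinder σ).inter (measurable_tailSeq _ hV)
    have := μCantor_step b hm
    rw [ih] at this
    rw [List.length_cons, pow_succ', mul_assoc, ← this]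
    congr 1
    ext X
    simp [isPrefixOf_cons, tailSeq_tailSeq, and_assoc]

theorem μCantor_cylinder (σ : List Bool) : μCantor (cylinder σ) = 2⁻¹ ^ σ.length := by
  have := μCantor_shift σ MeasurableSet.univ
  rw [measure_univ, mul_one] at this
  rw [← this]
  congr 1
  ext X
  exact ⟨fun h => ⟨h, trivial⟩, fun h => h.1⟩

/-- Concatenations of `n` strings from `T`. -/
def powStr (T : Set (List Bool)) (n : ℕ) : Set (List Bool) :=
  {σ | ∃ L : List (List Bool), L.length = n ∧ (∀ τ ∈ L, τ ∈ T) ∧ L.flatten = σ}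

theorem prefix_of_isPrefixOf {σ τ : List Bool} {X : ℕ → Bool} (h1 : IsPrefixOf σ X)
    (h2 : IsPrefixOf τ X) (h : σ.length ≤ τ.length) : σ <+: τ := by
  rw [isPrefixOf_iff] at h1 h2
  rw [h1, h2, ← strPrefix_take X h]
  exact List.take_prefix _ _

theorem tsum_prefixFree {T : Set (List Bool)} (hT : PrefixFreeSet T) :
    μCantor (openOf T) = ∑' σ : T, 2⁻¹ ^ (σ : List Bool).length := by
  rw [openOf, measure_biUnion T.to_countable _ fun σ _ => measurableSet_cylinder σ]
  · simp [μCantor_cylinder]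
  · intro σ hσ τ hτ hne
    rw [Function.onFun, Set.disjoint_left]
    intro X h1 h2
    rcases le_total σ.length τ.length with h | h
    · exact hne (hT σ hσ τ hτ (prefix_of_isPrefixOf h1 h2 h))
    · exact hne (hT τ hτ σ hσ (prefix_of_isPrefixOf h2 h1 h)).symm

theorem μCantor_powStr {T : Set (List Bool)} (hT : PrefixFreeSet T) (n : ℕ) :
    μCantor (openOf (powStr T n)) ≤ μCantor (openOf T) ^ n := by
  induction n with
  | zero => simpa using prob_le_one
  | succ n ih =>
    have hsub : openOf (powStr T (n + 1)) ⊆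
        ⋃ σ : T, {X | IsPrefixOf σ.1 X ∧ tailSeq X σ.1.length ∈ openOf (powStr T n)} := by
      intro X hX
      obtain ⟨_, ⟨L, hL, hLT, rfl⟩, hp⟩ := (mem_openOf _ _).1 hX
      cases L with
      | nil => simp at hL
      | cons τ L =>
        rw [List.flatten_cons, isPrefixOf_append] at hp
        refine Set.mem_iUnion.2 ⟨⟨τ, hLT τ (by simp)⟩, hp.1, (mem_openOf _ _).2 ⟨L.flatten, ⟨L, ?_, ?_, rfl⟩, hp.2⟩⟩
        · simpa using hL
        · intro ρ hρ; exact hLT ρ (by simp [hρ])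
    calc _ ≤ _ := measure_mono hsub
      _ ≤ _ := measure_iUnion_le _
      _ = ∑' σ : T, 2⁻¹ ^ (σ : List Bool).length * μCantor (openOf (powStr T n)) := by
        congr 1; funext σ; exact μCantor_shift σ.1 (measurableSet_openOf _)
      _ = μCantor (openOf T) * μCantor (openOf (powStr T n)) := by
        rw [ENNReal.tsum_mul_right, tsum_prefixFree hT]
      _ ≤ _ := by rw [pow_succ']; gcongr

theorem mem_powStr_of_tails {T : Set (List Bool)} (n : ℕ) (X : ℕ → Bool)
    (hX : ∀ k, tailSeq X k ∈ openOf T) : X ∈ openOf (powStr T n) := by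
  induction n generalizing X with
  | zero => exact (mem_openOf _ _).2 ⟨[], ⟨[], by simp, by simp, rfl⟩, isPrefixOf_nil X⟩
  | succ n ih =>
    obtain ⟨σ, hσ, hp⟩ := (mem_openOf _ _).1 (hX 0)
    obtain ⟨τ, ⟨L, hL, hLT, rfl⟩, hp'⟩ := (mem_openOf _ _).1
      (ih (tailSeq X σ.length) fun k => by rw [tailSeq_tailSeq]; exact hX _)
    refine (mem_openOf _ _).2 ⟨σ ++ L.flatten, ⟨σ :: L, by simp [hL], ?_, by simp⟩,
      (isPrefixOf_append _ _ _).2 ⟨hp, hp'⟩⟩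
    intro ρ hρ
    rcases List.mem_cons.1 hρ with rfl | h
    · exact hσ
    · exact hLT ρ h

/-! ### Computability -/

theorem exists_index {p : ℕ → Prop} (hp : REPred p) : ∃ e, ∀ n, WEnum e n ↔ p n := by
  have h1 : Partrec fun n : ℕ => (Part.assert (p n) fun _ => Part.some ()).map fun _ => (0 : ℕ) :=
    Partrec.map hp (Computable.const 0).to₂
  obtain ⟨c, hc⟩ := Nat.Partrec.Code.exists_code.1 (Partrec.nat_iff.1 h1)
  refine ⟨Encodable.encode c, fun n => ?_⟩
  unfold WEnum
  rw [Denumerable.ofNat_encode, hc]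
  simp [Part.assert]

/-- Stage approximation to the open set generated by a c.e. set of strings. -/
def stageD (c : Nat.Partrec.Code) (τ : List Bool) : Prop :=
  ∃ w < τ.length, (Nat.Partrec.Code.evaln τ.length c
    (Nat.pair (Encodable.encode ((List.range w.unpair.2.unpair.1).map fun _ => false))
      (Nat.pair (Encodable.encode (τ.take w.unpair.1)) w.unpair.2.unpair.2))).isSome = true

theorem primrec_stageD (c : Nat.Partrec.Code) : PrimrecPred (stageD c) := by
  have hR : PrimrecRel fun (w : ℕ) (τ : List Bool) =>
      (Nat.Partrec.Code.evaln τ.length c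
    (Nat.pair (Encodable.encode ((List.range w.unpair.2.unpair.1).map fun _ => false))
      (Nat.pair (Encodable.encode (τ.take w.unpair.1)) w.unpair.2.unpair.2))).isSome = true := by
    have hw : Primrec fun a : ℕ × List Bool => a.1.unpair := Primrec.unpair.comp Primrec.fst
    have hw2 : Primrec fun a : ℕ × List Bool => a.1.unpair.2.unpair :=
      Primrec.unpair.comp (Primrec.snd.comp hw)
    have h1 : Primrec fun a : ℕ × List Bool =>
        ((List.range a.1.unpair.2.unpair.1).map fun _ => false) :=
      Primrec.list_map (Primrec.list_range.comp (Primrec.fst.comp hw2)) (Primrec.const false).to₂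
    have h2 : Primrec fun a : ℕ × List Bool => a.2.take a.1.unpair.1 :=
      Primrec.list_take.comp (Primrec.fst.comp hw) Primrec.snd
    have h3 := Nat.Partrec.Code.primrec_evaln.comp
      (((Primrec.list_length.comp (Primrec.snd (α := ℕ) (β := List Bool))).pair (Primrec.const c)).pair
        (Primrec₂.natPair.comp (Primrec.encode.comp h1)
          (Primrec₂.natPair.comp (Primrec.encode.comp h2) (Primrec.snd.comp hw2))))
    exact (Primrec.eq (α := Bool)).comp (Primrec.option_isSome.comp h3) (Primrec.const true)
  have h0 := PrimrecRel.exists_mem_list hR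
  have h := PrimrecPred.comp h0
    ((Primrec.list_range.comp (Primrec.list_length (α := Bool))).pair Primrec.id)
  refine h.of_eq fun τ => ?_
  simp only [List.mem_range, id]
  rfl

theorem stageD_mono (c : Nat.Partrec.Code) {σ τ : List Bool} (h : σ <+: τ) (hσ : stageD c σ) :
    stageD c τ := by
  obtain ⟨w, hw, hs⟩ := hσ
  refine ⟨w, hw.trans_le h.length_le, ?_⟩
  have ht : τ.take w.unpair.1 = σ.take w.unpair.1 := by
    obtain ⟨ρ, rfl⟩ := h
    rw [List.take_append_of_le_length]
    exact (Nat.unpair_left_le w).trans hw.le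
  rw [ht]
  obtain ⟨x, hx⟩ := Option.isSome_iff_exists.1 hs
  exact Option.isSome_iff_exists.2 ⟨x, Nat.Partrec.Code.evaln_mono h.length_le hx⟩

/-- Minimal strings of the approximation. -/
def minD (c : Nat.Partrec.Code) : Set (List Bool) :=
  {τ | stageD c τ ∧ (τ.length = 0 ∨ ¬ stageD c (τ.take (τ.length - 1)))}

theorem primrec_minD (c : Nat.Partrec.Code) : PrimrecPred fun τ => τ ∈ minD c := by
  have h := primrec_stageD c
  refine h.and (((Primrec.eq (α := ℕ)).comp Primrec.list_length (Primrec.const 0)).or ?_)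
  refine PrimrecPred.not (h.comp ?_)
  exact Primrec.list_take.comp
    (Primrec.nat_sub.comp Primrec.list_length (Primrec.const 1)) Primrec.id

theorem prefixFree_minD (c : Nat.Partrec.Code) : PrefixFreeSet (minD c) := by
  rintro σ ⟨hσ, -⟩ τ ⟨-, hτ⟩ h
  by_contra hne
  have hlt : σ.length < τ.length :=
    lt_of_le_of_ne h.length_le fun he => hne (h.eq_of_length he)
  rcases hτ with h0 | h1
  · omega
  · refine h1 (stageD_mono c ?_ hσ)
    rw [List.prefix_iff_eq_take.1 h]
    refine List.take_prefix_take_left ?_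
    omega

theorem openOf_minD (c : Nat.Partrec.Code) : openOf (minD c) = openOf {τ | stageD c τ} := by
  classical
  ext X
  rw [mem_openOf', mem_openOf']
  constructor
  · rintro ⟨n, hn, -⟩; exact ⟨n, hn⟩
  · intro h
    refine ⟨Nat.find h, Nat.find_spec h, ?_⟩
    rw [strPrefix_length]
    rcases Nat.eq_zero_or_pos (Nat.find h) with h0 | h0
    · exact Or.inl h0
    · right
      rw [strPrefix_take X (Nat.sub_le _ _)]
      exact Nat.find_min h (by omega)

theorem openOf_stageD {S : Set (List Bool)} {e : ℕ}
    (he : ∀ σ : List Bool, σ ∈ S ↔ ∃ m, OracleComputes e emptyOracle (Encodable.encode σ) m) :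
    openOf {τ | stageD (Denumerable.ofNat Nat.Partrec.Code e) τ} = openOf S := by
  ext X
  rw [mem_openOf', mem_openOf']
  constructor
  · rintro ⟨n, w, hw, hs⟩
    rw [strPrefix_length] at hw
    rw [strPrefix_take X ((Nat.unpair_left_le w).trans hw.le)] at hs
    refine ⟨w.unpair.1, (he _).2 ⟨w.unpair.2.unpair.2, _, isPrefixOf_strPrefix emptyOracle w.unpair.2.unpair.1, ?_⟩⟩
    obtain ⟨x, hx⟩ := Option.isSome_iff_exists.1 hs
    exact Part.dom_iff_mem.2 ⟨x, Nat.Partrec.Code.evaln_sound hx⟩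
  · rintro ⟨i, hi⟩
    obtain ⟨m, ρ, hρ, hW⟩ := (he _).1 hi
    obtain ⟨x, hx⟩ := Part.dom_iff_mem.1 hW
    obtain ⟨k, hk⟩ := Nat.Partrec.Code.evaln_complete.1 hx
    set w := Nat.pair i (Nat.pair ρ.length m) with hw
    refine ⟨max k (w + 1), w, by rw [strPrefix_length]; omega, ?_⟩
    rw [strPrefix_length, strPrefix_take X (by have := Nat.unpair_left_le w; omega)]
    refine Option.isSome_iff_exists.2 ⟨x, Nat.Partrec.Code.evaln_mono (le_max_left _ _) ?_⟩
    rw [(isPrefixOf_iff _ _).1 hρ] at hk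
    simp only [hw, Nat.unpair_pair]
    exact hk

/-- The powers of a primitive recursive set of strings are uniformly c.e. -/
theorem exists_test_index {T : Set (List Bool)} (hT : PrimrecPred fun τ => τ ∈ T) (k : ℕ) :
    ∃ e, ∀ n, openOf (powStr T (k * n)) = testLevel e emptyOracle n := by
  let dL : ℕ → List (List Bool) := fun m => (Encodable.decode (α := List (List Bool)) m).getD []
  have hdL : Primrec dL := Primrec.option_getD.comp Primrec.decode (Primrec.const [])
  let R : ℕ → Prop := fun a =>
    (dL a.unpair.2.unpair.2).length = k * a.unpair.2.unpair.1.unpair.1 ∧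
    (∀ τ ∈ dL a.unpair.2.unpair.2, τ ∈ T) ∧
    Encodable.encode (dL a.unpair.2.unpair.2).flatten = a.unpair.2.unpair.1.unpair.2
  have hR : PrimrecPred R := by
    have ha : Primrec fun a : ℕ => a.unpair.2.unpair :=
      Primrec.unpair.comp (Primrec.snd.comp Primrec.unpair)
    have hb : Primrec fun a : ℕ => a.unpair.2.unpair.1.unpair :=
      Primrec.unpair.comp (Primrec.fst.comp ha)
    have hl : Primrec fun a : ℕ => dL a.unpair.2.unpair.2 := hdL.comp (Primrec.snd.comp ha)
    refine PrimrecPred.and ?_ (PrimrecPred.and ?_ ?_)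
    · exact Primrec.eq.comp (Primrec.list_length.comp hl)
        (Primrec.nat_mul.comp (Primrec.const k) (Primrec.fst.comp hb))
    · exact hT.forall_mem_list.comp hl
    · exact Primrec.eq.comp (Primrec.encode.comp (Primrec.list_flatten.comp hl))
        (Primrec.snd.comp hb)
  obtain ⟨e, he⟩ := exists_index hR.computablePred.to_re
  refine ⟨e, fun n => ?_⟩
  unfold testLevel
  congr 1
  ext σ
  simp only [powStr, Set.mem_ofPred_eq, OracleComputes, he]
  constructor
  · rintro ⟨L, h1, h2, rfl⟩
    refine ⟨Encodable.encode L, [], isPrefixOf_nil _, ?_⟩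
    simp only [R, dL, Nat.unpair_pair, Encodable.encodek, Option.getD_some]
    exact ⟨h1, h2, trivial⟩
  · rintro ⟨m, ρ, -, h1, h2, h3⟩
    simp only [Nat.unpair_pair] at h1 h2 h3
    exact ⟨dL m, h1, h2, Encodable.encode_injective h3⟩

/-- Kučera's theorem. -/
theorem kucera {P : Set (ℕ → Bool)} (hP : Pi01 P) (hpos : 0 < μCantor P) {X : ℕ → Bool}
    (hX : MLRandom X) : ∃ k, tailSeq X k ∈ P := by
  by_contra! hcon
  obtain ⟨S, ⟨e, he⟩, rfl⟩ := hP
  set c := Denumerable.ofNat Nat.Partrec.Code e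
  have hU : openOf (minD c) = openOf S := (openOf_minD c).trans (openOf_stageD he)
  rw [← hU] at hcon hpos
  have hq : μCantor (openOf (minD c)) < 1 := by
    rw [prob_compl_eq_one_sub (measurableSet_openOf _)] at hpos
    exact tsub_pos_iff_lt.1 hpos
  obtain ⟨k, hk⟩ : ∃ k, μCantor (openOf (minD c)) ^ k < 2⁻¹ :=
    ((ENNReal.tendsto_pow_atTop_nhds_zero_of_lt_one hq).eventually_lt_const (by simp)).exists
  obtain ⟨e', he'⟩ := exists_test_index (primrec_minD c) k
  have hm : ∀ n, μCantor (openOf (powStr (minD c) (k * n))) ≤ 2⁻¹ ^ n := by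
    intro n
    refine (μCantor_powStr (prefixFree_minD c) _).trans ?_
    rw [pow_mul]
    gcongr
  obtain ⟨n, hn⟩ := hX (fun n => openOf (powStr (minD c) (k * n))) ⟨⟨e', he'⟩, hm⟩
  exact hn (mem_powStr_of_tails _ X fun j => not_not.1 (hcon j))

/-- If a tail of `X` is random relative to `A`, so is `X`. -/
theorem random_of_tail {A X : ℕ → Bool} {k : ℕ} (h : MLRandomIn A (tailSeq X k)) :
    MLRandomIn A X := by
  rintro G ⟨⟨e, he⟩, hG⟩
  by_contra! hcon
  set σ := strPrefix X k with hσ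
  have hσl : σ.length = k := strPrefix_length X k
  let dl : ℕ → List Bool := fun m => (Encodable.decode (α := List Bool) m).getD []
  have hdl : Primrec dl := Primrec.option_getD.comp Primrec.decode (Primrec.const [])
  let F : ℕ → ℕ := fun a => (Nat.pair a.unpair.1 (Nat.pair (Nat.pair (a.unpair.2.unpair.1.unpair.1 + k)
      (Encodable.encode ((σ ++ dl a.unpair.2.unpair.1.unpair.2).take a.unpair.2.unpair.2.unpair.1)))
      a.unpair.2.unpair.2.unpair.2))
  have hF : Primrec F := by
    have ha : Primrec fun a : ℕ => a.unpair.2.unpair :=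
      Primrec.unpair.comp (Primrec.snd.comp Primrec.unpair)
    have hb : Primrec fun a : ℕ => a.unpair.2.unpair.1.unpair :=
      Primrec.unpair.comp (Primrec.fst.comp ha)
    have hc : Primrec fun a : ℕ => a.unpair.2.unpair.2.unpair :=
      Primrec.unpair.comp (Primrec.snd.comp ha)
    refine Primrec₂.natPair.comp (Primrec.fst.comp Primrec.unpair) (Primrec₂.natPair.comp
      (Primrec₂.natPair.comp (Primrec.nat_add.comp (Primrec.fst.comp hb) (Primrec.const k)) ?_)
      (Primrec.snd.comp hc))
    exact Primrec.encode.comp (Primrec.list_take.comp (Primrec.fst.comp hc)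
      (Primrec.list_append.comp (Primrec.const σ) (hdl.comp (Primrec.snd.comp hb))))
  have hre : REPred fun a => WEnum e (F a) :=
    ((Partrec.nat_iff.2 (Nat.Partrec.Code.exists_code.2
      ⟨Denumerable.ofNat Nat.Partrec.Code e, rfl⟩)).comp hF.to_comp).dom_re
  obtain ⟨e', he'⟩ := exists_index hre
  have hdec : ∀ τ : List Bool, dl (Encodable.encode τ) = τ := fun τ => by simp [dl]
  let φ : (ℕ → Bool) → ℕ → Bool := fun Y n => if n < k then X n else Y (n - k)
  have hφpre : ∀ Y, IsPrefixOf σ (φ Y) := by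
    intro Y i
    have h1 := isPrefixOf_strPrefix X k i
    have hi : (i : ℕ) < k := by have := i.2; omega
    simp only [φ, hi, if_true]
    exact h1
  have hφtail : ∀ Y, tailSeq (φ Y) k = Y := by
    intro Y; funext n; simp [tailSeq, φ]
  have hφ : ∀ Z, IsPrefixOf σ Z → φ (tailSeq Z k) = Z := by
    intro Z hZ
    funext n
    by_cases hn : n < k
    · have h1 := hZ ⟨n, by omega⟩
      have h2 := isPrefixOf_strPrefix X k ⟨n, by rw [strPrefix_length]; exact hn⟩
      simp only [φ, hn, if_true]
      exact h2.trans h1.symm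
    · simp only [φ, hn, if_false, tailSeq]
      congr 1; omega
  have happ : ∀ Y j, σ ++ strPrefix Y j = strPrefix (φ Y) (k + j) := by
    intro Y j
    have h1 : IsPrefixOf (σ ++ strPrefix Y j) (φ Y) := by
      rw [isPrefixOf_append, hσl, hφtail]
      exact ⟨hφpre Y, isPrefixOf_strPrefix Y j⟩
    have h2 := (isPrefixOf_iff _ _).1 h1
    rwa [List.length_append, hσl, strPrefix_length] at h2
  have key : ∀ n Y, Y ∈ testLevel e' A n ↔ φ Y ∈ G (n + k) := by
    intro n Y
    rw [he]
    unfold testLevel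
    rw [mem_openOf', mem_openOf']
    simp only [Set.mem_ofPred_eq, OracleComputes, he', F, Nat.unpair_pair, hdec, happ]
    constructor
    · rintro ⟨j, m, ρ, hρ, hW⟩
      rcases le_total m.unpair.1 (k + j) with hle | hle
      · rw [strPrefix_take _ hle] at hW
        exact ⟨_, _, ρ, hρ, hW⟩
      · rw [List.take_of_length_le (by rw [strPrefix_length]; exact hle)] at hW
        exact ⟨_, _, ρ, hρ, hW⟩
    · rintro ⟨j, m, ρ, hρ, hW⟩
      refine ⟨j, Nat.pair j m, ρ, hρ, ?_⟩
      rw [Nat.unpair_pair, strPrefix_take _ (Nat.le_add_left j k)]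
      exact hW
  have hm : ∀ n, μCantor (testLevel e' A n) ≤ 2⁻¹ ^ n := by
    intro n
    have h1 := μCantor_shift σ (V := testLevel e' A n) (measurableSet_openOf _)
    have h2 : {Z | IsPrefixOf σ Z ∧ tailSeq Z σ.length ∈ testLevel e' A n} ⊆ G (n + k) := by
      rintro Z ⟨hZ, hZ'⟩
      rwa [hσl, key, hφ Z hZ] at hZ'
    have h3 := (h1.symm.le.trans (measure_mono h2)).trans (hG (n + k))
    rw [hσl, pow_add, mul_comm (2⁻¹ ^ n)] at h3
    have hne0 : (2⁻¹ : ℝ≥0∞) ^ k ≠ 0 := by simp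
    have hnet : (2⁻¹ : ℝ≥0∞) ^ k ≠ ⊤ := by simp
    exact (ENNReal.mul_le_mul_iff_right hne0 hnet).1 h3
  obtain ⟨n, hn⟩ := h (testLevel e' A) ⟨⟨e', fun _ => rfl⟩, hm⟩
  apply hn
  rw [key, hφ X (isPrefixOf_strPrefix X k)]
  exact hcon _

/-- if a positive-measure `Π⁰₁` class is contained in a `Π⁰₁(A)`
class of `A`-randoms, then `A` is low for Martin-Löf randomness. -/
theorem stmt7 (A : ℕ → Bool) (P Q : Set (ℕ → Bool))
    (hP : Pi01 P) (hpos : 0 < μCantor P)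
    (hQ : Pi01In A Q) (hQrand : ∀ X ∈ Q, MLRandomIn A X)
    (hPQ : P ⊆ Q) :
    ∀ X : ℕ → Bool, MLRandom X → MLRandomIn A X := by
  intro X hX
  obtain ⟨k, hk⟩ := kucera hP hpos hX
  exact random_of_tail (hQrand _ (hPQ hk))
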